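/- arXiv:2311.16568 — 3 statements merged into one kernel-verified Lean document; each statement's English description precedes it below -/
import Mathlib

section
/- For every matrix Γ ∈ ℂ^{n×l} and every Hermitian positive definite matrix Ω ∈ ℂ^{l×l}, one has log((det Ω).re) − (trace(Ω · E(Γ))).re + l ≤ log((det(I_n + A B Bᴴ Aᴴ N⁻¹)).re). (This is the '≤' half of the WMMSE principle: the weighted-MSE surrogate never exceeds the log-determinant.) -/
open Matrix ComplexOrder

lemma aux_logdet {l : ℕ} (M : Matrix (Fin l) (Fin l) ℂ) (hM : M.PosDef) :
    Real.log M.det.re ≤ M.trace.re - l := by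
  have h1 : M.det.re = ∏ i, hM.isHermitian.eigenvalues i := by
    rw [hM.isHermitian.det_eq_prod_eigenvalues]
    rw [← Complex.ofReal_re (∏ i, hM.isHermitian.eigenvalues i)]
    push_cast
    rfl
  have h2 : M.trace.re = ∑ i, hM.isHermitian.eigenvalues i := by
    rw [hM.isHermitian.trace_eq_sum_eigenvalues]
    rw [← Complex.ofReal_re (∑ i, hM.isHermitian.eigenvalues i)]
    push_cast
    rfl
  rw [h1, h2, Real.log_prod (fun i _ => (hM.eigenvalues_pos i).ne')]
  calc _ ≤ ∑ i, (hM.isHermitian.eigenvalues i - 1) :=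
        Finset.sum_le_sum fun i _ => Real.log_le_sub_one_of_pos (hM.eigenvalues_pos i)
    _ = _ := by simp

open scoped MatrixOrder Matrix.Norms.L2Operator in
lemma aux_decomp {l : ℕ} (M : Matrix (Fin l) (Fin l) ℂ) (hM : M.PosDef) :
    ∃ C : Matrix (Fin l) (Fin l) ℂ, IsUnit C ∧ M = Cᴴ * C := by
  obtain ⟨C, hu, hC⟩ := CStarAlgebra.isStrictlyPositive_iff_eq_star_mul_self.mp
    hM.isStrictlyPositive
  exact ⟨C, hu, hC⟩

lemma aux_trace_nonneg {l : ℕ} (Ω P : Matrix (Fin l) (Fin l) ℂ) (hΩ : Ω.PosDef)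
    (hP : P.PosSemidef) : 0 ≤ (Ω * P).trace.re := by
  obtain ⟨C, -, rfl⟩ := aux_decomp Ω hΩ
  have h := (hP.mul_mul_conjTranspose_same C).trace_nonneg
  rw [Matrix.mul_assoc, Matrix.trace_mul_comm]
  exact (Complex.le_def.mp h).1

lemma aux_key {l : ℕ} (Ω S : Matrix (Fin l) (Fin l) ℂ) (hΩ : Ω.PosDef) (hS : S.PosDef) :
    Real.log Ω.det.re - (Ω * S⁻¹).trace.re + l ≤ Real.log S.det.re := by
  obtain ⟨C, hCu, hC⟩ := aux_decomp _ hS.inv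
  have hM : (C * Ω * Cᴴ).PosDef := (Matrix.IsUnit.posDef_star_right_conjugate_iff hCu).mpr hΩ
  have h := aux_logdet _ hM
  have ht : (C * Ω * Cᴴ).trace = (Ω * S⁻¹).trace := by
    rw [hC, Matrix.mul_assoc, Matrix.trace_mul_comm, Matrix.mul_assoc]
  have hd : (C * Ω * Cᴴ).det * S.det = Ω.det := by
    have : S⁻¹.det * S.det = 1 := by
      rw [← Matrix.det_mul, Matrix.nonsing_inv_mul _ ((Matrix.isUnit_iff_isUnit_det _).mp hS.isUnit),
        Matrix.det_one]
    rw [hC, Matrix.det_mul] at this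
    rw [Matrix.det_mul, Matrix.det_mul]
    linear_combination Ω.det * this
  have p1 := Complex.lt_def.mp hM.det_pos
  have p2 := Complex.lt_def.mp hS.det_pos
  have hr : Ω.det.re = (C * Ω * Cᴴ).det.re * S.det.re := by
    rw [← hd, Complex.mul_re, ← p1.2, ← p2.2]; simp
  rw [hr, Real.log_mul p1.1.ne' p2.1.ne']
  rw [ht] at h
  linarith

theorem wmmse_surrogate_le {n p l : ℕ} (hn : 0 < n) (hp : 0 < p) (hl : 0 < l)
    (A : Matrix (Fin n) (Fin p) ℂ) (B : Matrix (Fin p) (Fin l) ℂ)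
    (N : Matrix (Fin n) (Fin n) ℂ) (hN : N.PosDef)
    (Γ : Matrix (Fin n) (Fin l) ℂ)
    (Ω : Matrix (Fin l) (Fin l) ℂ) (hΩ : Ω.PosDef) :
    Real.log (Ω.det.re)
      - (Matrix.trace (Ω *
          ((1 - Γᴴ * A * B) * (1 - Γᴴ * A * B)ᴴ + Γᴴ * N * Γ))).re
      + (l : ℝ)
    ≤ Real.log (((1 : Matrix (Fin n) (Fin n) ℂ)
        + A * B * Bᴴ * Aᴴ * N⁻¹).det.re) := by
  obtain ⟨H, hH⟩ : ∃ H, H = A * B := ⟨_, rfl⟩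
  have e1 : A * B * Bᴴ * Aᴴ * N⁻¹ = H * (Hᴴ * N⁻¹) := by
    rw [hH, Matrix.conjTranspose_mul]; simp only [Matrix.mul_assoc]
  have e2 : Γᴴ * A * B = Γᴴ * H := by rw [hH, Matrix.mul_assoc]
  rw [e1, e2, Matrix.det_one_add_mul_comm]
  clear e1 e2 hH
  have hS : (1 + Hᴴ * N⁻¹ * H).PosDef :=
    Matrix.PosDef.one.add_posSemidef (hN.inv.posSemidef.conjTranspose_mul_mul_same H)
  have hR : (N + H * Hᴴ).PosDef :=
    hN.add_posSemidef (Matrix.posSemidef_self_mul_conjTranspose H)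
  have hNu := (Matrix.isUnit_iff_isUnit_det _).mp hN.isUnit
  obtain ⟨R, hRdef⟩ : ∃ R, R = N + H * Hᴴ := ⟨_, rfl⟩
  rw [← hRdef] at hR
  have hRu := (Matrix.isUnit_iff_isUnit_det _).mp hR.isUnit
  have hinv : (1 + Hᴴ * N⁻¹ * H)⁻¹ = 1 - Hᴴ * R⁻¹ * H := by
    apply Matrix.inv_eq_left_inv
    have h3 : R⁻¹ * H + R⁻¹ * (H * Hᴴ) * N⁻¹ * H = N⁻¹ * H := by
      have : H * Hᴴ = R - N := by rw [hRdef]; abel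
      rw [this, Matrix.mul_sub, Matrix.nonsing_inv_mul _ hRu, Matrix.sub_mul, Matrix.sub_mul,
        Matrix.mul_assoc R⁻¹ N, Matrix.mul_nonsing_inv _ hNu]
      simp
    have h4 : Hᴴ * (R⁻¹ * H + R⁻¹ * (H * Hᴴ) * N⁻¹ * H) = Hᴴ * (N⁻¹ * H) := by rw [h3]
    simp only [Matrix.mul_add, Matrix.sub_mul, Matrix.mul_one, Matrix.one_mul,
      Matrix.mul_assoc] at h4 ⊢
    generalize Hᴴ * (R⁻¹ * (H * (Hᴴ * (N⁻¹ * H)))) = Y at h4 ⊢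
    generalize Hᴴ * (R⁻¹ * H) = X at h4 ⊢
    rw [← h4]
    abel
  have hE : (1 - Γᴴ * H) * (1 - Γᴴ * H)ᴴ + Γᴴ * N * Γ
      = (1 + Hᴴ * N⁻¹ * H)⁻¹ + (Γ - R⁻¹ * H)ᴴ * R * (Γ - R⁻¹ * H) := by
    have hRH : (R⁻¹)ᴴ = R⁻¹ := hR.inv.isHermitian
    have hN' : N = R - H * Hᴴ := by rw [hRdef]; abel
    have c1 : ∀ X : Matrix (Fin n) (Fin l) ℂ, R * (R⁻¹ * X) = X := fun X => by
      rw [← Matrix.mul_assoc, Matrix.mul_nonsing_inv _ hRu, Matrix.one_mul]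
    have c2 : ∀ X : Matrix (Fin n) (Fin l) ℂ, R⁻¹ * (R * X) = X := fun X => by
      rw [← Matrix.mul_assoc, Matrix.nonsing_inv_mul _ hRu, Matrix.one_mul]
    rw [hinv, hN']
    simp only [Matrix.conjTranspose_sub, Matrix.conjTranspose_mul, Matrix.conjTranspose_one,
      Matrix.conjTranspose_conjTranspose, hRH, Matrix.mul_sub, Matrix.sub_mul, Matrix.mul_one,
      Matrix.one_mul, Matrix.mul_assoc, c1, c2]
    abel
  have hP := aux_trace_nonneg Ω _ hΩ (hR.posSemidef.conjTranspose_mul_mul_same (Γ - R⁻¹ * H))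
  have hk := aux_key Ω _ hΩ hS
  rw [hE, Matrix.mul_add, Matrix.trace_add, Complex.add_re]
  linarith
end

section
/- With Γ_opt = (N + A B Bᴴ Aᴴ)⁻¹ A B and Ω_opt = (I_l − Γ_optᴴ A B)⁻¹, equality holds in the WMMSE bound: log((det Ω_opt).re) − (trace(Ω_opt · E(Γ_opt))).re + l = log((det(I_n + A B Bᴴ Aᴴ N⁻¹)).re). -/
open Matrix ComplexOrder

/-- Equality in the WMMSE bound at `Γ_opt = (N + A B Bᴴ Aᴴ)⁻¹ A B` and
`Ω_opt = (I − Γ_optᴴ A B)⁻¹`. -/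
theorem wmmse_surrogate_eq_at_opt {n p l : ℕ} (hn : 0 < n) (hp : 0 < p) (hl : 0 < l)
    (A : Matrix (Fin n) (Fin p) ℂ) (B : Matrix (Fin p) (Fin l) ℂ)
    (N : Matrix (Fin n) (Fin n) ℂ) (hN : N.PosDef) :
    let Γopt : Matrix (Fin n) (Fin l) ℂ := (N + A * B * Bᴴ * Aᴴ)⁻¹ * (A * B)
    let Ωopt : Matrix (Fin l) (Fin l) ℂ := (1 - Γoptᴴ * A * B)⁻¹
    Real.log (Ωopt.det.re)
      - (Matrix.trace (Ωopt *
          ((1 - Γoptᴴ * A * B) * (1 - Γoptᴴ * A * B)ᴴ + Γoptᴴ * N * Γopt))).re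
      + (l : ℝ)
    = Real.log (((1 : Matrix (Fin n) (Fin n) ℂ)
        + A * B * Bᴴ * Aᴴ * N⁻¹).det.re) := by
  intro Γopt Ωopt
  obtain ⟨C, hC⟩ : ∃ C, C = A * B := ⟨_, rfl⟩
  obtain ⟨M, hM⟩ : ∃ M, M = N + C * Cᴴ := ⟨_, rfl⟩
  have e1 : A * B * Bᴴ * Aᴴ = C * Cᴴ := by
    rw [hC, conjTranspose_mul, Matrix.mul_assoc (A * B)]
  have hMpd : M.PosDef := by
    rw [hM]; exact hN.add_posSemidef (posSemidef_self_mul_conjTranspose C)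
  have uM : IsUnit M.det := (isUnit_iff_isUnit_det _).1 hMpd.isUnit
  have uN : IsUnit N.det := (isUnit_iff_isUnit_det _).1 hN.isUnit
  have hG : Γopt = M⁻¹ * C := by
    simp only [Γopt]; rw [e1, ← hC, ← hM]
  have hGH : Γoptᴴ = Cᴴ * M⁻¹ := by
    rw [hG, conjTranspose_mul, hMpd.isHermitian.inv.eq]
  obtain ⟨S, hS⟩ : ∃ S, S = 1 - Cᴴ * M⁻¹ * C := ⟨_, rfl⟩
  have hS' : 1 - Γoptᴴ * A * B = S := by
    rw [hS, hGH, Matrix.mul_assoc _ A B, ← hC]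
  have hSH : Sᴴ = S := by
    rw [hS]
    simp [conjTranspose_mul, hMpd.isHermitian.inv.eq, Matrix.mul_assoc]
  have hE : S * Sᴴ + Γoptᴴ * N * Γopt = S := by
    have hNM : N = M - C * Cᴴ := by rw [hM]; simp
    have h1 : M⁻¹ * (M * (M⁻¹ * C)) = M⁻¹ * C := by
      rw [nonsing_inv_mul_cancel_left _ _ uM]
    rw [hSH, hGH, hG, hNM, hS]
    simp only [Matrix.mul_sub, Matrix.sub_mul, Matrix.mul_assoc, h1, Matrix.mul_one,
      Matrix.one_mul]
    abel
  have hdet : S.det = N.det * (M.det)⁻¹ := by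
    have h2 : S.det = (1 - C * (Cᴴ * M⁻¹)).det := by
      rw [hS, det_one_sub_mul_comm]
    have h3 : 1 - C * (Cᴴ * M⁻¹) = N * M⁻¹ := by
      have hNM : N = M - C * Cᴴ := by rw [hM]; simp
      rw [hNM, Matrix.sub_mul, mul_nonsing_inv _ uM, Matrix.mul_assoc]
    rw [h2, h3, det_mul, det_nonsing_inv, Ring.inverse_eq_inv']
  have uS : IsUnit S.det := by
    rw [hdet]; exact uN.mul uM.inv
  have hO : Ωopt = S⁻¹ := by simp only [Ωopt]; rw [hS']
  have hR : (1 + C * Cᴴ * N⁻¹).det = M.det * (N.det)⁻¹ := by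
    have h3 : 1 + C * Cᴴ * N⁻¹ = M * N⁻¹ := by
      rw [hM, Matrix.add_mul, mul_nonsing_inv _ uN]
    rw [h3, det_mul, det_nonsing_inv, Ring.inverse_eq_inv']
  rw [hS', hE, hO, nonsing_inv_mul _ uS, e1, hR, det_nonsing_inv, Ring.inverse_eq_inv', hdet,
    mul_inv, inv_inv, mul_comm]
  simp
end

section
/- Let M ≥ 1 be an integer, C₀ ≥ 0 and a > 0 real numbers, and let a₁, …, a_M be reals with 0 ≤ a_m ≤ a for all m. Then (Σ_{m=1}^M a_m)² / (1 + C₀ Σ_{m=1}^M a_m²) ≤ M² a² / (1 + C₀ M a²), and equality holds if and only if a₁ = a₂ = ⋯ = a_M = a. -/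
/-- For amplitudes `0 ≤ aₘ ≤ a`,
`(Σ aₘ)² / (1 + C₀ Σ aₘ²) ≤ M² a² / (1 + C₀ M a²)`,
with equality iff all `aₘ = a`. -/
theorem sum_sq_ratio_le_max (M : ℕ) (hM : 1 ≤ M) (C₀ a : ℝ)
    (hC₀ : 0 ≤ C₀) (ha : 0 < a) (x : Fin M → ℝ)
    (hx : ∀ m, 0 ≤ x m ∧ x m ≤ a) :
    (∑ m, x m) ^ 2 / (1 + C₀ * ∑ m, (x m) ^ 2)
      ≤ (M : ℝ) ^ 2 * a ^ 2 / (1 + C₀ * M * a ^ 2)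
    ∧ ((∑ m, x m) ^ 2 / (1 + C₀ * ∑ m, (x m) ^ 2)
        = (M : ℝ) ^ 2 * a ^ 2 / (1 + C₀ * M * a ^ 2) ↔ ∀ m, x m = a) := by
  have hCS : (∑ m, x m) ^ 2 ≤ (M : ℝ) * ∑ m, (x m) ^ 2 := by
    simpa using sq_sum_le_card_mul_sum_sq (s := Finset.univ) (f := x)
  have hS0 : 0 ≤ ∑ m, x m := Finset.sum_nonneg fun m _ => (hx m).1
  have hQ0 : 0 ≤ ∑ m, (x m) ^ 2 := Finset.sum_nonneg fun m _ => sq_nonneg _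
  have hconst : ∑ _m : Fin M, a = (M : ℝ) * a := by simp
  have hSM : ∑ m, x m ≤ (M : ℝ) * a := by
    rw [← hconst]
    exact Finset.sum_le_sum fun m _ => (hx m).2
  have heqS : (M : ℝ) * a ≤ ∑ m, x m → ∀ m, x m = a := by
    intro h m
    rw [← hconst] at h hSM
    exact (Finset.sum_eq_sum_iff_of_le (fun m _ => (hx m).2)).1 (le_antisymm hSM h) m
      (Finset.mem_univ m)
  have hQeq : (∀ m, x m = a) → ∑ m, (x m) ^ 2 = (M : ℝ) * a ^ 2 := by
    intro h
    simp [h]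
  have hSeq : (∀ m, x m = a) → ∑ m, x m = (M : ℝ) * a := by
    intro h
    simp [h]
  generalize ∑ m, x m = S at *
  generalize ∑ m, (x m) ^ 2 = Q at *
  have hd1 : 0 < 1 + C₀ * Q := by positivity
  have hd2 : 0 < 1 + C₀ * M * a ^ 2 := by positivity
  have hk : 0 ≤ C₀ * M * a ^ 2 := by positivity
  have h1 : C₀ * M * a ^ 2 * S ^ 2 ≤ C₀ * M * a ^ 2 * (M * Q) :=
    mul_le_mul_of_nonneg_left hCS hk
  have h2 : S ^ 2 ≤ (M * a) ^ 2 := pow_le_pow_left₀ hS0 hSM 2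
  refine ⟨?_, ?_, ?_⟩
  · rw [div_le_div_iff₀ hd1 hd2]
    linarith
  · intro h
    rw [div_eq_div_iff hd1.ne' hd2.ne'] at h
    apply heqS
    have h3 : (M * a) ^ 2 ≤ S ^ 2 := by linarith
    exact (sq_le_sq₀ (by positivity) hS0).1 h3
  · intro h
    rw [hQeq h, hSeq h]
    ring
end
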